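/- Suppose in addition that G is abelian. Then for every n ≥ 0 the induced k-linear map ⊕_{x∈G} ν^n_{G,x,α} : ⊕_{x∈G} H^n(G, k x̄) → HH^n(k_αG) is an isomorphism of k-vector spaces (an additive centralizers group-cohomology decomposition of the Hochschild cohomology of the twisted group algebra). -/

import Mathlib

/- Common setup: twisted group algebras modelled on their canonical basis.
An element of the twisted group algebra `k_αG` is modelled as a function `G → k`
(its coordinates in the basis `{ḡ : g ∈ G}`), and a Hochschild `n`-cochain
`Hom_k((k_αG)^{⊗n}, M)` is modelled by its values on basis tensors, i.e. as a
function `(Fin n → G) → M`.  Similarly a group cochain `C^n(H, A)` is a function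
`(Fin n → H) → A`; the one-dimensional module `k x̄` is modelled as `k` with the
action of `h` given by multiplication by the character `χ(h) = α(h,x)·α(x,h)⁻¹`. -/

namespace TwistedSym

section Defs

variable {k : Type*} [CommRing k] {G : Type*} [Group G] [DecidableEq G]
variable {M : Type*} [AddCommGroup M] [Module k M]
variable {H : Type*} [Group H]
variable {A : Type*} [AddCommGroup A] [DistribMulAction H A]

/-- The 2-cocycle condition `α(x,yz)α(y,z) = α(xy,z)α(x,y)`. -/
def IsCocycle (α : G → G → kˣ) : Prop :=
  ∀ x y z : G, α x (y * z) * α y z = α (x * y) z * α x y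

/-- Normalization `α(1,x) = α(x,1) = 1`. -/
def IsNormalized (α : G → G → kˣ) : Prop :=
  ∀ x : G, α 1 x = 1 ∧ α x 1 = 1

/-- `(L, R)` encode a `(k_αG, k_αG)`-bimodule structure on the `k`-module `M`:
`L g` is left multiplication by the basis element `ḡ` and `R g` is right
multiplication by `ḡ`. -/
def IsBimodule (α : G → G → kˣ) (L R : G → M →ₗ[k] M) : Prop :=
  (∀ m : M, L 1 m = m) ∧ (∀ m : M, R 1 m = m) ∧
  (∀ (g h : G) (m : M), L g (L h m) = (α g h : k) • L (g * h) m) ∧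
  (∀ (g h : G) (m : M), R h (R g m) = (α g h : k) • R (g * h) m) ∧
  (∀ (g h : G) (m : M), L g (R h m) = R h (L g m))

/-- The tuple of group elements appearing in the action of the transposition
`σ_{i0+1} = (i0+1, i0+2)` on `n`-cochains (0-indexed `i0 : Fin n`):
position `i0 - 1` gets `g_{i0-1}·g_{i0}`, position `i0` gets `g_{i0}⁻¹` and
position `i0 + 1` gets `g_{i0}·g_{i0+1}` (when these positions exist). -/
def swapTuple {n : ℕ} (i0 : Fin n) (g : Fin n → H) : Fin n → H := fun j =>
  if (j : ℕ) + 1 = (i0 : ℕ) then g j * g i0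
  else if j = i0 then (g i0)⁻¹
  else if (j : ℕ) = (i0 : ℕ) + 1 then g i0 * g j
  else g j

/-- The action of the transposition `σ_{i0+1} = (i0+1,i0+2) ∈ Σ_{n+1}` on Hochschild
`n`-cochains of the twisted group algebra `k_αG` with coefficients in the bimodule `M`.
All the `α`-scalars come from rewriting products and inverses of basis elements in
terms of basis elements: `ḡ·h̄ = α(g,h)·(gh)‾` and `ḡ⁻¹ = α(g,g⁻¹)⁻¹·(g⁻¹)‾`. -/
def hSigma (α : G → G → kˣ) (L R : G → M →ₗ[k] M) {n : ℕ} (i0 : Fin n)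
    (φ : (Fin n → G) → M) : (Fin n → G) → M := fun g =>
  -(((if 0 < (i0 : ℕ) then
        (α (g ⟨(i0 : ℕ) - 1, lt_of_le_of_lt (Nat.sub_le _ _) i0.isLt⟩) (g i0) : k) else 1) *
     (((α (g i0) (g i0)⁻¹)⁻¹ : kˣ) : k) *
     (if h : (i0 : ℕ) + 1 < n then (α (g i0) (g ⟨(i0 : ℕ) + 1, h⟩) : k) else 1)) •
    (if (i0 : ℕ) = 0 then
        L (g i0) (if (i0 : ℕ) + 1 = n then R (g i0) (φ (swapTuple i0 g)) else φ (swapTuple i0 g))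
      else (if (i0 : ℕ) + 1 = n then R (g i0) (φ (swapTuple i0 g)) else φ (swapTuple i0 g))))

/-- Staic's action of the transposition `σ_{i0+1} ∈ Σ_{n+1}` on group `n`-cochains
with values in an `H`-module `A`. -/
def gSigma {n : ℕ} (i0 : Fin n) (ψ : (Fin n → H) → A) : (Fin n → H) → A := fun h =>
  -(if (i0 : ℕ) = 0 then h i0 • ψ (swapTuple i0 h) else ψ (swapTuple i0 h))

/-- Staic's action of the transposition `σ_{i0+1} ∈ Σ_{n+1}` on group `n`-cochains
with values in the rank-one module `k` on which `H` acts through the character `χ`. -/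
def cSigma (χ : H → k) {n : ℕ} (i0 : Fin n) (ψ : (Fin n → H) → k) : (Fin n → H) → k := fun h =>
  -(if (i0 : ℕ) = 0 then χ (h i0) * ψ (swapTuple i0 h) else ψ (swapTuple i0 h))

/-- The `(n+1)`-tuple `g` with entries at positions `j, j+1` multiplied together. -/
def mergeAt {n : ℕ} (g : Fin (n + 1) → H) (j : Fin n) : Fin n → H := fun l =>
  if (l : ℕ) < (j : ℕ) then g (Fin.castSucc l)
  else if l = j then g (Fin.castSucc l) * g (Fin.succ l)
  else g (Fin.succ l)

/-- The Hochschild differential `δ^n` for the twisted group algebra `k_αG` with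
coefficients in the bimodule `M`, written on basis tensors (the scalar
`α(g_j, g_{j+1})` comes from `ḡ_j·ḡ_{j+1} = α(g_j,g_{j+1})·(g_jg_{j+1})‾`). -/
def hDiff (α : G → G → kˣ) (L R : G → M →ₗ[k] M) {n : ℕ}
    (φ : (Fin n → G) → M) : (Fin (n + 1) → G) → M := fun g =>
  L (g 0) (φ fun j => g j.succ)
    + ∑ j : Fin n, ((-1 : ℤ) ^ ((j : ℕ) + 1)) •
        ((α (g j.castSucc) (g j.succ) : k) • φ (mergeAt g j))
    + ((-1 : ℤ) ^ (n + 1)) • R (g (Fin.last n)) (φ fun j => g j.castSucc)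

/-- The group cohomology differential `∂^n` for cochains on `H` with values in the
`H`-module `A`. -/
def gDiff {n : ℕ} (ψ : (Fin n → H) → A) : (Fin (n + 1) → H) → A := fun h =>
  h 0 • ψ (fun j => h j.succ)
    + ∑ j : Fin n, ((-1 : ℤ) ^ ((j : ℕ) + 1)) • ψ (mergeAt h j)
    + ((-1 : ℤ) ^ (n + 1)) • ψ (fun j => h j.castSucc)

/-- The group cohomology differential `∂^n` for cochains on `H` with values in the
rank-one module `k` on which `H` acts through the character `χ`. -/
def cDiff (χ : H → k) {n : ℕ} (ψ : (Fin n → H) → k) : (Fin (n + 1) → H) → k := fun h =>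
  χ (h 0) * ψ (fun j => h j.succ)
    + ∑ j : Fin n, ((-1 : ℤ) ^ ((j : ℕ) + 1)) • ψ (mergeAt h j)
    + ((-1 : ℤ) ^ (n + 1)) • ψ (fun j => h j.castSucc)

/-- Left multiplication by the basis element `ḡ` on `k_αG` (modelled as `G → k`). -/
def Lmul (α : G → G → kˣ) (g : G) : (G → k) →ₗ[k] (G → k) where
  toFun a := fun y => (α g (g⁻¹ * y) : k) * a (g⁻¹ * y)
  map_add' a b := by funext y; simp [mul_add]
  map_smul' c a := by funext y; simp [smul_eq_mul]; ring

/-- Right multiplication by the basis element `ḡ` on `k_αG` (modelled as `G → k`). -/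
def Rmul (α : G → G → kˣ) (g : G) : (G → k) →ₗ[k] (G → k) where
  toFun a := fun y => (α (y * g⁻¹) g : k) * a (y * g⁻¹)
  map_add' a b := by funext y; simp [mul_add]
  map_smul' c a := by funext y; simp [smul_eq_mul]; ring

/-- Iterated right multiplication: `rmuls α [g₁,…,gₙ] v = v·ḡ₁·…·ḡₙ`. -/
def rmuls (α : G → G → kˣ) (l : List G) (v : G → k) : G → k :=
  l.foldl (fun w g => Rmul α g w) v

/-- Iterated right multiplication by inverses of basis elements:
`rinvs α [h₁,…,hₙ] v = v·h̄ₙ⁻¹·…·h̄₁⁻¹`, using `h̄⁻¹ = α(h,h⁻¹)⁻¹·(h⁻¹)‾`. -/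
def rinvs (α : G → G → kˣ) (l : List G) (v : G → k) : G → k :=
  l.foldr (fun h w => (((α h h⁻¹)⁻¹ : kˣ) : k) • Rmul α h⁻¹ w) v

/-- The character through which `h ∈ C_G(x)` acts on the module `k x̄`:
`χ(h) = α(h,x)·α(x,h)⁻¹`. -/
def chi (α : G → G → kˣ) (x : G) : G → k := fun h =>
  (α h x : k) * (((α x h)⁻¹ : kˣ) : k)

/-- The map `π^n_{G,x,α} : C^n(k_αG, k_αG) → C^n(C_G(x), k x̄)`: the value on
`(h₁,…,hₙ)` is the coefficient of the basis element `x̄` in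
`φ(h̄₁⊗…⊗h̄ₙ)·h̄ₙ⁻¹·…·h̄₁⁻¹` (identifying `k x̄` with `k`). -/
def piC (α : G → G → kˣ) (x : G) {n : ℕ} (φ : (Fin n → G) → (G → k)) :
    (Fin n → Subgroup.centralizer ({x} : Set G)) → k := fun h =>
  rinvs α (List.ofFn fun i => (h i : G)) (φ fun i => (h i : G)) x

/-- The same map as `piC` for a central element `x`, in which case `C_G(x) = G`:
`π^n_{G,x,α} : C^n(k_αG, k_αG) → C^n(G, k x̄)`. -/
def piZ (α : G → G → kˣ) (x : G) {n : ℕ} (φ : (Fin n → G) → (G → k)) :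
    (Fin n → G) → k := fun h =>
  rinvs α (List.ofFn h) (φ h) x

/-- The map `ν^n_{G,x,α} : C^n(G, k x̄) → C^n(k_αG, k_αG)` for `x ∈ Z(G)`:
`ψ ↦ (ḡ₁⊗…⊗ḡₙ ↦ ψ(g₁,…,gₙ)·x̄·ḡ₁·…·ḡₙ)` (identifying `k x̄` with `k`). -/
def nuZ (α : G → G → kˣ) (x : G) {n : ℕ} (ψ : (Fin n → G) → k) :
    (Fin n → G) → (G → k) := fun g =>
  ψ g • rmuls α (List.ofFn g) (Pi.single x 1)

/-- Iteration of the index map of a coset decomposition along a list of group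
elements: `chainIdx idx j [g₁,…,gᵢ]` is the index `s_j^i`. -/
def chainIdx {m : ℕ} (idx : Fin m → G → Fin m) (j : Fin m) : List G → Fin m
  | [] => j
  | a :: l => chainIdx idx (idx j a) l

/-- The map `ν^n_{G,x} : C^n(C_G(x), kx) → C^n(kG, kG)` for the (untwisted) group
algebra, relative to a right coset decomposition `G = ⋃ⱼ C_G(x)γⱼ`:
`ν(ψ)(g₁⊗…⊗gₙ) = Σⱼ ψ(h_{j,1},…,h_{j,n})·x⁻¹·xⱼ·g₁⋯gₙ` where
`xⱼ = γⱼ⁻¹xγⱼ`, the `h_{j,i} = rep (s_j^{i-1}) gᵢ ∈ C_G(x)` are determined by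
`γ_{s_j^{i-1}}·gᵢ = h_{j,i}·γ_{s_j^i}` and `kx` is identified with `k`. -/
def nuT (x : G) {m n : ℕ} (γ : Fin m → G) (idx : Fin m → G → Fin m)
    (rep : Fin m → G → G)
    (hrep : ∀ j a, rep j a ∈ Subgroup.centralizer ({x} : Set G))
    (ψ : (Fin n → Subgroup.centralizer ({x} : Set G)) → k) :
    (Fin n → G) → (G → k) := fun g =>
  ∑ j : Fin m,
    ψ (fun i => ⟨rep (chainIdx idx j ((List.ofFn g).take (i : ℕ))) (g i), hrep _ _⟩) •
      (Pi.single ((γ j)⁻¹ * x * γ j * (List.ofFn g).prod) (1 : k) : G → k)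

/-- `φ` is a Hochschild coboundary (for `n = 0` the coboundary space is `0`). -/
def IsHCoboundary (α : G → G → kˣ) (L R : G → M →ₗ[k] M) :
    ∀ {n : ℕ}, ((Fin n → G) → M) → Prop
  | 0, φ => φ = 0
  | _ + 1, φ => ∃ θ, φ = hDiff α L R θ

/-- `φ` is the Hochschild coboundary of a `Σ`-invariant cochain. -/
def IsHSCoboundary (α : G → G → kˣ) (L R : G → M →ₗ[k] M) :
    ∀ {n : ℕ}, ((Fin n → G) → M) → Prop
  | 0, φ => φ = 0
  | _ + 1, φ => ∃ θ, (∀ i0, hSigma α L R i0 θ = θ) ∧ φ = hDiff α L R θ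

/-- `ψ` is a group-cohomology coboundary (coefficients in `k` through `χ`). -/
def IsCCoboundary (χ : H → k) : ∀ {n : ℕ}, ((Fin n → H) → k) → Prop
  | 0, ψ => ψ = 0
  | _ + 1, ψ => ∃ θ, ψ = cDiff χ θ

/-- `ψ` is the coboundary of a `Σ`-invariant group cochain (coefficients through `χ`). -/
def IsCSCoboundary (χ : H → k) : ∀ {n : ℕ}, ((Fin n → H) → k) → Prop
  | 0, ψ => ψ = 0
  | _ + 1, ψ => ∃ θ, (∀ i0, cSigma χ i0 θ = θ) ∧ ψ = cDiff χ θ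

/-- `ψ` is a group-cohomology coboundary (coefficients in the `H`-module `A`). -/
def IsGCoboundary : ∀ {n : ℕ}, ((Fin n → H) → A) → Prop
  | 0, ψ => ψ = 0
  | _ + 1, ψ => ∃ θ, ψ = gDiff θ

/-- `ψ` is the coboundary of a `Σ`-invariant group cochain (coefficients in `A`). -/
def IsGSCoboundary : ∀ {n : ℕ}, ((Fin n → H) → A) → Prop
  | 0, ψ => ψ = 0
  | _ + 1, ψ => ∃ θ, (∀ i0, gSigma i0 θ = θ) ∧ ψ = gDiff θ

end Defs

section NuDecomposition

variable {k : Type*} [CommRing k] {G : Type*} [Group G]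

lemma Rmul_Rmul {α : G → G → kˣ} (hα : IsCocycle α) (g h : G) (v : G → k) :
    Rmul α h (Rmul α g v) = (α g h : k) • Rmul α (g * h) v := by
  funext y
  have key : (α (y * h⁻¹ * g⁻¹) (g * h) : k) * α g h
      = α (y * h⁻¹) h * α (y * h⁻¹ * g⁻¹) g := by
    have := congrArg (Units.val) (hα (y * h⁻¹ * g⁻¹) g h)
    simpa using this
  simp only [Rmul, LinearMap.coe_mk, AddHom.coe_mk, Pi.smul_apply, smul_eq_mul, mul_inv_rev,
    ← mul_assoc] at *
  rw [← key]
  ring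

lemma Lmul_Rmul {α : G → G → kˣ} (hα : IsCocycle α) (g h : G) (v : G → k) :
    Lmul α g (Rmul α h v) = Rmul α h (Lmul α g v) := by
  funext y
  have key : (α g (g⁻¹ * y) : k) * α (g⁻¹ * y * h⁻¹) h
      = α (y * h⁻¹) h * α g (g⁻¹ * y * h⁻¹) := by
    have := congrArg (Units.val) (hα g (g⁻¹ * y * h⁻¹) h)
    simpa [mul_assoc] using this
  simp only [Rmul, Lmul, LinearMap.coe_mk, AddHom.coe_mk, ← mul_assoc] at *
  rw [key]

lemma Lmul_rmuls {α : G → G → kˣ} (hα : IsCocycle α) (g : G) (l : List G) (v : G → k) :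
    Lmul α g (rmuls α l v) = rmuls α l (Lmul α g v) := by
  induction l generalizing v with
  | nil => rfl
  | cons h l ih =>
    change Lmul α g (rmuls α l (Rmul α h v)) = rmuls α l (Rmul α h (Lmul α g v))
    rw [ih, Lmul_Rmul hα]

lemma rmuls_smul (α : G → G → kˣ) (l : List G) (c : k) (v : G → k) :
    rmuls α l (c • v) = c • rmuls α l v := by
  induction l generalizing v with
  | nil => rfl
  | cons h l ih =>
    change rmuls α l (Rmul α h (c • v)) = c • rmuls α l (Rmul α h v)
    rw [map_smul, ih]

lemma Lmul_single [DecidableEq G] {α : G → G → kˣ} (hab : ∀ a b : G, a * b = b * a) (g x : G) :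
    Lmul α g (Pi.single x 1) = chi α x g • Rmul α g (Pi.single x 1) := by
  funext y
  simp only [Lmul, Rmul, chi, LinearMap.coe_mk, AddHom.coe_mk, Pi.smul_apply, smul_eq_mul]
  rw [hab y g⁻¹]
  by_cases h : g⁻¹ * y = x
  · simp [h, mul_assoc]
  · simp [h]

lemma mergeAt_zero {n : ℕ} (g : Fin (n + 2) → G) :
    mergeAt g 0 = Fin.cons (g 0 * g 1) fun j => g j.succ.succ := by
  funext l
  cases l using Fin.cases <;> simp [mergeAt, Fin.ext_iff]

lemma mergeAt_succ {n : ℕ} (g : Fin (n + 2) → G) (j : Fin n) :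
    mergeAt g j.succ = Fin.cons (g 0) (mergeAt (fun i => g i.succ) j) := by
  funext l
  cases l using Fin.cases <;> simp [mergeAt, Fin.ext_iff]

lemma rmuls_mergeAt {α : G → G → kˣ} (hα : IsCocycle α) {n : ℕ} (g : Fin (n + 1) → G)
    (j : Fin n) (v : G → k) :
    (α (g j.castSucc) (g j.succ) : k) • rmuls α (List.ofFn (mergeAt g j)) v
      = rmuls α (List.ofFn g) v := by
  induction n generalizing v with
  | zero => exact j.elim0
  | succ n ih =>
    cases j using Fin.cases with
    | zero =>
      rw [mergeAt_zero, List.ofFn_cons, List.ofFn_succ, List.ofFn_succ]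
      change _ • rmuls α _ (Rmul α (g 0 * g 1) v) = rmuls α _ (Rmul α (g 1) (Rmul α (g 0) v))
      rw [Rmul_Rmul hα, rmuls_smul]
      rfl
    | succ j =>
      rw [mergeAt_succ, List.ofFn_cons, List.ofFn_succ]
      exact ih (fun i => g i.succ) j (Rmul α (g 0) v)

lemma Rmul_rmuls_init (α : G → G → kˣ) {n : ℕ} (g : Fin (n + 1) → G) (v : G → k) :
    Rmul α (g (Fin.last n)) (rmuls α (List.ofFn fun j : Fin n => g j.castSucc) v)
      = rmuls α (List.ofFn g) v := by
  rw [List.ofFn_succ' g, List.concat_eq_append]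
  simp [rmuls, List.foldl_append]

lemma hDiff_nuZ [DecidableEq G] {α : G → G → kˣ} (hab : ∀ a b : G, a * b = b * a)
    (hα : IsCocycle α) (x : G) {n : ℕ} (ψ : (Fin n → G) → k) :
    hDiff α (Lmul α) (Rmul α) (nuZ α x ψ) = nuZ α x (cDiff (chi α x) ψ) := by
  funext g
  have hL : Lmul α (g 0) (nuZ α x ψ fun j => g j.succ)
      = (chi α x (g 0) * ψ fun j => g j.succ) • rmuls α (List.ofFn g) (Pi.single x 1) := by
    rw [nuZ, map_smul, Lmul_rmuls hα, Lmul_single hab, rmuls_smul, smul_smul, mul_comm,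
      List.ofFn_succ]
    rfl
  have hM (j : Fin n) : (α (g j.castSucc) (g j.succ) : k) • nuZ α x ψ (mergeAt g j)
      = ψ (mergeAt g j) • rmuls α (List.ofFn g) (Pi.single x 1) := by
    rw [nuZ, smul_comm, rmuls_mergeAt hα]
  have hR : Rmul α (g (Fin.last n)) (nuZ α x ψ fun j => g j.castSucc)
      = (ψ fun j => g j.castSucc) • rmuls α (List.ofFn g) (Pi.single x 1) := by
    rw [nuZ, map_smul, Rmul_rmuls_init]
  simp only [hDiff, hL, hM, hR]
  simp only [nuZ, cDiff, add_smul, Finset.sum_smul, smul_assoc]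

lemma hDiff_sum {M : Type*} [AddCommGroup M] [Module k M] {ι : Type*} (s : Finset ι)
    (α : G → G → kˣ) (L R : G → M →ₗ[k] M) {n : ℕ} (φ : ι → (Fin n → G) → M) :
    hDiff α L R (∑ i ∈ s, φ i) = ∑ i ∈ s, hDiff α L R (φ i) := by
  funext g
  simp only [hDiff, Finset.sum_apply, map_sum, Finset.smul_sum, Finset.sum_add_distrib]
  rw [Finset.sum_comm]

/-- The unit `c` with `ȳ·ḡ₁·…·ḡₙ = c·(yg₁⋯gₙ)‾`. -/
def rmulsCoeff (α : G → G → kˣ) : List G → G → kˣ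
  | [], _ => 1
  | g :: l, y => rmulsCoeff α l (y * g) * α y g

lemma rmuls_apply_mul_prod (α : G → G → kˣ) (l : List G) (v : G → k) (y : G) :
    rmuls α l v (y * l.prod) = rmulsCoeff α l y * v y := by
  induction l generalizing v y with
  | nil => simp [rmuls, rmulsCoeff]
  | cons g l ih =>
    change rmuls α l (Rmul α g v) _ = _
    rw [List.prod_cons, ← mul_assoc, ih]
    simp [Rmul, rmulsCoeff, mul_assoc]

variable [Fintype G] [DecidableEq G]

lemma sum_nuZ_apply_mul_prod (α : G → G → kˣ) {n : ℕ} (ψf : G → (Fin n → G) → k)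
    (g : Fin n → G) (z : G) :
    (∑ y, nuZ α y (ψf y)) g (z * (List.ofFn g).prod)
      = rmulsCoeff α (List.ofFn g) z * ψf z g := by
  simp [nuZ, Finset.sum_apply, rmuls_apply_mul_prod, Pi.single_apply, mul_comm]

lemma sum_nuZ_injective (α : G → G → kˣ) {n : ℕ} :
    Function.Injective fun ψf : G → (Fin n → G) → k => ∑ y, nuZ α y (ψf y) := by
  intro ψ ψ' h
  funext z g
  have := congrFun (congrFun h g) (z * (List.ofFn g).prod)
  simpa only [sum_nuZ_apply_mul_prod, Units.mul_right_inj] using this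

lemma sum_nuZ_surjective (α : G → G → kˣ) {n : ℕ} :
    Function.Surjective fun ψf : G → (Fin n → G) → k => ∑ y, nuZ α y (ψf y) := by
  intro φ
  refine ⟨fun z g => ((rmulsCoeff α (List.ofFn g) z)⁻¹ : kˣ) * φ g (z * (List.ofFn g).prod), ?_⟩
  funext g w
  obtain ⟨z, rfl⟩ : ∃ z, w = z * (List.ofFn g).prod := ⟨w * (List.ofFn g).prod⁻¹, by simp⟩
  simp only [sum_nuZ_apply_mul_prod, Units.mul_inv_cancel_left]

lemma hDiff_sum_nuZ {α : G → G → kˣ} (hab : ∀ a b : G, a * b = b * a) (hα : IsCocycle α) {n : ℕ}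
    (ψf : G → (Fin n → G) → k) :
    hDiff α (Lmul α) (Rmul α) (∑ y, nuZ α y (ψf y))
      = ∑ y, nuZ α y (cDiff (chi α y) (ψf y)) := by
  simp only [hDiff_sum, hDiff_nuZ hab hα]

end NuDecomposition

/-- if `G` is abelian, the induced map
`⊕_{x∈G} ν^n_{G,x,α} : ⊕_{x∈G} H^n(G, k x̄) → HH^n(k_αG)` is an isomorphism of
`k`-vector spaces (injective and surjective on cohomology). -/
theorem nu_iso_abelian
    {k : Type*} [Field k] {G : Type*} [Group G] [Fintype G] [DecidableEq G]
    (hab : ∀ a b : G, a * b = b * a)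
    (α : G → G → kˣ) (hα : IsCocycle α) (hnorm : IsNormalized α) {n : ℕ} :
    (∀ ψf : G → (Fin n → G) → k,
      (∀ x : G, cDiff (chi α x) (ψf x) = 0) →
      IsHCoboundary α (Lmul α) (Rmul α) (∑ y : G, nuZ α y (ψf y)) →
      ∀ x : G, IsCCoboundary (chi α x) (ψf x)) ∧
    (∀ φ : (Fin n → G) → (G → k), hDiff α (Lmul α) (Rmul α) φ = 0 →
      ∃ ψf : G → (Fin n → G) → k,
        (∀ x : G, cDiff (chi α x) (ψf x) = 0) ∧
        IsHCoboundary α (Lmul α) (Rmul α) (φ - ∑ y : G, nuZ α y (ψf y))) := by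
  refine ⟨fun ψf _ hb x => ?_, fun φ hφ => ?_⟩
  · cases n with
    | zero =>
      have h : ψf = 0 := sum_nuZ_injective α
        ((show ∑ y, nuZ α y (ψf y) = 0 from hb).trans (by ext; simp [nuZ]))
      exact congrFun h x
    | succ n =>
      obtain ⟨θ, hθ⟩ := hb
      obtain ⟨ψ, rfl⟩ := sum_nuZ_surjective α θ
      exact ⟨ψ x, congrFun (sum_nuZ_injective α (hθ.trans (hDiff_sum_nuZ hab hα ψ))) x⟩
  · obtain ⟨ψ, rfl⟩ := sum_nuZ_surjective α φ
    refine ⟨ψ, fun x => ?_, ?_⟩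
    · have h : (fun y => cDiff (chi α y) (ψ y)) = 0 := sum_nuZ_injective α
        ((hDiff_sum_nuZ hab hα ψ).symm.trans (hφ.trans (by ext; simp [nuZ])))
      exact congrFun h x
    · rw [sub_self]
      cases n with
      | zero => rfl
      | succ n => exact ⟨0, by funext g; simp [hDiff]⟩

end TwistedSym
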